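/- Let Δ be a simplicial complex on [n] over an infinite field K, Δ^e its exterior algebraic shifted complex and Δ^c any combinatorial shifted complex of Δ. Then for all i and d one has m_{≤i}(J_{Δ^e}, d) ≥ m_{≤i}(J_{Δ^c}, d). -/

import Mathlib

/-- The exterior algebra `E = ⋀ V` of an `n`-dimensional `K`-vector space `V`
with distinguished basis `e_1, …, e_n` (modeled on `V = Fin n → K`). -/
abbrev ExtAlg (K : Type) [Field K] (n : ℕ) := ExteriorAlgebra K (Fin n → K)

/-- The monomial `e_σ = e_{j_1} ∧ ⋯ ∧ e_{j_d}` for `σ = {j_1 < ⋯ < j_d} ⊆ [n]`. -/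
noncomputable def eMon (K : Type) [Field K] (n : ℕ) (σ : Finset (Fin n)) : ExtAlg K n :=
  ((σ.sort (· ≤ ·)).map fun k => ExteriorAlgebra.ι K (Pi.single k (1 : K))).prod

/-- The span of the degree-`d` monomials: the image of `⋀^d V` in `E`. -/
noncomputable def monSpan (K : Type) [Field K] (n : ℕ) (d : ℕ) :
    Submodule K (ExtAlg K n) :=
  Submodule.span K {x | ∃ σ : Finset (Fin n), σ.card = d ∧ x = eMon K n σ}

/-- A subspace of `E` is a (two-sided) ideal. -/
def IsIdealE {K : Type} [Field K] {n : ℕ} (I : Submodule K (ExtAlg K n)) : Prop :=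
  ∀ x y : ExtAlg K n, y ∈ I → x * y ∈ I ∧ y * x ∈ I

/-- A subspace of `E` is (graded) homogeneous. -/
def IsHomogE {K : Type} [Field K] {n : ℕ} (I : Submodule K (ExtAlg K n)) : Prop :=
  I = ⨆ d : ℕ, I ⊓ monSpan K n d

/-- The two-sided ideal of `E` generated by a set. -/
noncomputable def idealSpanE (K : Type) [Field K] (n : ℕ) (s : Set (ExtAlg K n)) :
    Submodule K (ExtAlg K n) :=
  Submodule.span K {x | ∃ a ∈ s, ∃ u v : ExtAlg K n, x = u * a * v}

/-- The exterior face ideal `J_Δ ⊆ E`, generated by the monomials `e_σ`, `σ ∉ Δ`. -/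
noncomputable def faceIdealE (K : Type) [Field K] {n : ℕ} (Δ : Set (Finset (Fin n))) :
    Submodule K (ExtAlg K n) :=
  idealSpanE K n {x | ∃ σ : Finset (Fin n), σ ∉ Δ ∧ x = eMon K n σ}

/-- `e_τ ≤_rev e_σ` in the reverse lexicographic order induced by `e_1 > ⋯ > e_n`:
either `τ = σ`, or the largest element of the symmetric difference belongs to `τ`. -/
def revLexLe {n : ℕ} (τ σ : Finset (Fin n)) : Prop :=
  τ = σ ∨ ∃ k ∈ τ, k ∉ σ ∧ ∀ l ∈ σ, l ∉ τ → l < k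

/-- The span of the monomials `e_ρ` of degree `|σ|` with `e_ρ ≤_rev e_σ`. -/
noncomputable def monSpanLe (K : Type) [Field K] {n : ℕ} (σ : Finset (Fin n)) :
    Submodule K (ExtAlg K n) :=
  Submodule.span K
    {x | ∃ ρ : Finset (Fin n), ρ.card = σ.card ∧ revLexLe ρ σ ∧ x = eMon K n ρ}

/-- The span of the monomials `e_ρ` of degree `|σ|` with `e_ρ <_rev e_σ`. -/
noncomputable def monSpanLt (K : Type) [Field K] {n : ℕ} (σ : Finset (Fin n)) :
    Submodule K (ExtAlg K n) :=
  Submodule.span K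
    {x | ∃ ρ : Finset (Fin n), ρ.card = σ.card ∧ revLexLe ρ σ ∧ ρ ≠ σ ∧ x = eMon K n ρ}

/-- `e_σ` is the initial monomial (with respect to `<_rev`) of some element of `I`. -/
def IsInitialMonomial {K : Type} [Field K] {n : ℕ} (I : Submodule K (ExtAlg K n))
    (σ : Finset (Fin n)) : Prop :=
  ∃ f ∈ I, f ∈ monSpanLe K σ ∧ f ∉ monSpanLt K σ ∧ f ≠ 0

/-- The initial ideal `in_{<rev}(I)` of a homogeneous ideal `I ⊆ E`. -/
noncomputable def initialIdealE (K : Type) [Field K] {n : ℕ}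
    (I : Submodule K (ExtAlg K n)) : Submodule K (ExtAlg K n) :=
  Submodule.span K {x | ∃ σ : Finset (Fin n), IsInitialMonomial I σ ∧ x = eMon K n σ}

/-- The algebra automorphism of `E` induced by an (invertible) matrix `g`,
i.e. the action of `GL(n;K)` on `E`. -/
noncomputable def matAlgMap (K : Type) [Field K] {n : ℕ} (g : Matrix (Fin n) (Fin n) K) :
    ExtAlg K n →ₐ[K] ExtAlg K n :=
  ExteriorAlgebra.map (Matrix.toLin' g)

/-- The image `φ(I)` of a subspace `I ⊆ E` under the action of a matrix `φ = g`. -/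
noncomputable def applyMat (K : Type) [Field K] {n : ℕ} (g : Matrix (Fin n) (Fin n) K)
    (I : Submodule K (ExtAlg K n)) : Submodule K (ExtAlg K n) :=
  Submodule.map (matAlgMap K g).toLinearMap I

/-- `J` is the generic initial ideal `Gin^E(I)` of `I`: there is a nonempty Zariski
open subset `U` of `GL(n;K)` (the nonvanishing locus of a nonzero polynomial in the
matrix entries) such that `in_{<rev}(φ(I)) = J` for every `φ ∈ U`. -/
def IsGinE {K : Type} [Field K] {n : ℕ} (I J : Submodule K (ExtAlg K n)) : Prop :=
  ∃ p : MvPolynomial (Fin n × Fin n) K, p ≠ 0 ∧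
    ∀ g : Matrix (Fin n) (Fin n) K, IsUnit g.det →
      MvPolynomial.eval (fun kl => g kl.1 kl.2) p ≠ 0 →
        initialIdealE K (applyMat K g I) = J

/-- `m_{≤i}(J, d)`: the number of monomials `e_σ ∈ J` of degree `d` with
`m(e_σ) = max σ ≤ i` (in the `1`-based labelling `[n] = {1, …, n}`). -/
noncomputable def mLeE {K : Type} [Field K] {n : ℕ} (J : Submodule K (ExtAlg K n))
    (i d : ℕ) : ℕ :=
  Nat.card {σ : Finset (Fin n) // σ.card = d ∧ (∀ k ∈ σ, (k : ℕ) < i) ∧ eMon K n σ ∈ J}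

open Classical in
/-- The matrix `M_τ(I,d)`: the submatrix of `M(I,d) = (α_a^σ)` consisting of the
columns indexed by the `d`-element subsets `σ` with `e_τ ≤_rev e_σ` (realized by
zeroing out all other columns, which does not change the rank). -/
noncomputable def MtauMatrix {K : Type} [Field K] {n : ℕ} {s : ℕ}
    (α : Fin s → Finset (Fin n) → K) (d : ℕ) (τ : Finset (Fin n)) :
    Matrix (Fin s) (Finset (Fin n)) K :=
  Matrix.of fun a σ => if σ.card = d ∧ τ.card = d ∧ revLexLe τ σ then α a σ else 0

open Classical in
/-- The matrix `M'_τ(I,d)`: the submatrix of `M_τ(I,d)` obtained by removing the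
column indexed by `τ` (realized by zeroing out all other columns). -/
noncomputable def MtauMatrix' {K : Type} [Field K] {n : ℕ} {s : ℕ}
    (α : Fin s → Finset (Fin n) → K) (d : ℕ) (τ : Finset (Fin n)) :
    Matrix (Fin s) (Finset (Fin n)) K :=
  Matrix.of fun a σ =>
    if σ.card = d ∧ τ.card = d ∧ revLexLe τ σ ∧ σ ≠ τ then α a σ else 0

/-- `f : Fin s → E` is a `K`-basis of the degree-`d` part `I_d = I ⊓ ⋀^d V` of `I`. -/
def IsBasisOfDegPart {K : Type} [Field K] {n : ℕ} (I : Submodule K (ExtAlg K n))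
    (d s : ℕ) (f : Fin s → ExtAlg K n) : Prop :=
  LinearIndependent K f ∧ Submodule.span K (Set.range f) = I ⊓ monSpan K n d

/-- `α` is the coefficient matrix of `φ(f_1), …, φ(f_s)` in the monomial basis:
`φ(f_a) = ∑_{|σ| = d} α_a^σ e_σ`. -/
def IsCoeffMatrix {K : Type} [Field K] {n : ℕ} (g : Matrix (Fin n) (Fin n) K)
    {s : ℕ} (f : Fin s → ExtAlg K n) (α : Fin s → Finset (Fin n) → K) (d : ℕ) : Prop :=
  ∀ a : Fin s, matAlgMap K g (f a) =
    ∑ σ ∈ Finset.univ.filter (fun σ : Finset (Fin n) => σ.card = d), α a σ • eMon K n σ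

/-- `σ_(i,d) = {i − d + 1, i − d + 2, …, i} ⊆ [n]` (in `1`-based labelling). -/
def sigmaSet (n i d : ℕ) : Finset (Fin n) :=
  Finset.univ.filter fun k : Fin n => i - d ≤ (k : ℕ) ∧ (k : ℕ) < i

open Classical in
/-- `C_{ij}(σ)`, the basic combinatorial shifting operation on a single face. -/
noncomputable def shiftFace {n : ℕ} (Δ : Set (Finset (Fin n))) (i j : Fin n)
    (σ : Finset (Fin n)) : Finset (Fin n) :=
  if i ∈ σ ∧ j ∉ σ ∧ insert j (σ.erase i) ∉ Δ then insert j (σ.erase i) else σ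

/-- `Shift_{ij}(Δ)`. -/
noncomputable def shiftOp {n : ℕ} (Δ : Set (Finset (Fin n))) (i j : Fin n) :
    Set (Finset (Fin n)) :=
  (shiftFace Δ i j) '' Δ

/-- A simplicial complex on `[n]`, modeled as a set of finsets of `Fin n`. -/
def IsSimplicialComplex {n : ℕ} (Δ : Set (Finset (Fin n))) : Prop :=
  (∀ j : Fin n, {j} ∈ Δ) ∧ ∀ σ ∈ Δ, ∀ τ : Finset (Fin n), τ ⊆ σ → τ ∈ Δ

/-- A collection of faces is shifted. -/
def IsShifted {n : ℕ} (Δ : Set (Finset (Fin n))) : Prop :=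
  ∀ σ ∈ Δ, ∀ i ∈ σ, ∀ j : Fin n, i < j → j ∉ σ → insert j (σ.erase i) ∈ Δ

/-- `Δc` is a combinatorial shifted complex of `Δ`. -/
noncomputable def IsCombinatorialShiftedComplex {n : ℕ}
    (Δ Δc : Set (Finset (Fin n))) : Prop :=
  ∃ l : List (Fin n × Fin n), (∀ p ∈ l, p.1 < p.2) ∧
    Δc = l.foldl (fun Γ p => shiftOp Γ p.1 p.2) Δ ∧ IsShifted Δc

open ExteriorAlgebra

section Monomials

variable {K : Type} [Field K] {n : ℕ}

/-- Permuting the factors of a product of basis vectors changes it by a nonzero scalar. -/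
theorem exists_smul_prod_of_perm {l l' : List (Fin n)} (h : l.Perm l') :
    ∃ ε : K, ε ≠ 0 ∧ (l.map fun k => ι K (Pi.single k (1 : K))).prod =
      ε • (l'.map fun k => ι K (Pi.single k (1 : K))).prod := by
  induction h with
  | nil => exact ⟨1, one_ne_zero, by simp⟩
  | cons x _ ih =>
    obtain ⟨ε, hε, h⟩ := ih
    exact ⟨ε, hε, by simp [h]⟩
  | swap x y l =>
    refine ⟨-1, by simp, ?_⟩
    have := eq_neg_of_add_eq_zero_left
      (ι_add_mul_swap (R := K) (Pi.single y (1 : K) : Fin n → K) (Pi.single x 1))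
    simp only [List.map_cons, List.prod_cons, ← mul_assoc, this]
    simp
  | trans _ _ ih₁ ih₂ =>
    obtain ⟨ε, hε, h⟩ := ih₁
    obtain ⟨δ, hδ, h'⟩ := ih₂
    exact ⟨ε * δ, mul_ne_zero hε hδ, by rw [h, h', smul_smul]⟩

theorem exists_smul_eMon_insert {k : Fin n} {σ : Finset (Fin n)} (hk : k ∉ σ) :
    ∃ ε : K, ε ≠ 0 ∧ eMon K n (insert k σ) = ε • (ι K (Pi.single k (1 : K)) * eMon K n σ) := by
  have hp : ((insert k σ).sort (· ≤ ·)).Perm (k :: σ.sort (· ≤ ·)) := by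
    rw [List.perm_ext_iff_of_nodup (Finset.sort_nodup _ _)
      (List.nodup_cons.2 ⟨by simpa using hk, Finset.sort_nodup _ _⟩)]
    simp
  obtain ⟨ε, hε, h⟩ := exists_smul_prod_of_perm (K := K) hp
  exact ⟨ε, hε, by simpa [eMon] using h⟩

theorem ι_single_mul_eMon_of_mem {k : Fin n} {σ : Finset (Fin n)} (hk : k ∈ σ) :
    ι K (Pi.single k (1 : K)) * eMon K n σ = 0 := by
  obtain ⟨ε, -, h⟩ := exists_smul_eMon_insert (K := K) (Finset.notMem_erase k σ)
  rw [Finset.insert_erase hk] at h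
  rw [h, mul_smul_comm, ← mul_assoc, ι_sq_zero, zero_mul, smul_zero]

theorem matAlgMap_ι (g : Matrix (Fin n) (Fin n) K) (v : Fin n → K) :
    matAlgMap K g (ι K v) = ι K (g.mulVec v) := by
  simp [matAlgMap]

theorem matAlgMap_mul_apply (g h : Matrix (Fin n) (Fin n) K) (x : ExtAlg K n) :
    matAlgMap K (g * h) x = matAlgMap K g (matAlgMap K h x) := by
  rw [matAlgMap, matAlgMap, matAlgMap, Matrix.toLin'_mul, ← ExteriorAlgebra.map_comp_map]
  rfl

theorem matAlgMap_one_apply (x : ExtAlg K n) : matAlgMap K 1 x = x := by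
  simp [matAlgMap]

/-- A matrix fixing all basis vectors indexed by `σ` fixes the monomial `e_σ`. -/
theorem matAlgMap_eMon_of_fixed {g : Matrix (Fin n) (Fin n) K} {σ : Finset (Fin n)}
    (h : ∀ k ∈ σ, g.mulVec (Pi.single k 1) = Pi.single k 1) :
    matAlgMap K g (eMon K n σ) = eMon K n σ := by
  rw [eMon, map_list_prod, List.map_map]
  congr 1
  refine List.map_congr_left fun k hk => ?_
  rw [Function.comp_apply, matAlgMap_ι, h k (by simpa using hk)]

/-- A matrix killing some basis vector indexed by `σ` kills the monomial `e_σ`. -/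
theorem matAlgMap_eMon_of_killed {g : Matrix (Fin n) (Fin n) K} {σ : Finset (Fin n)} {k : Fin n}
    (hk : k ∈ σ) (h : g.mulVec (Pi.single k 1) = 0) :
    matAlgMap K g (eMon K n σ) = 0 := by
  obtain ⟨ε, -, he⟩ := exists_smul_eMon_insert (K := K) (Finset.notMem_erase k σ)
  rw [Finset.insert_erase hk] at he
  simp [he, matAlgMap_ι, h]

theorem ι_mul_mem_monSpan (v : Fin n → K) {d : ℕ} {x : ExtAlg K n} (hx : x ∈ monSpan K n d) :
    ι K v * x ∈ monSpan K n (d + 1) := by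
  have hv : v = ∑ k, v k • (Pi.single k (1 : K) : Fin n → K) := by
    ext l; simp [Finset.sum_apply, Pi.single_apply]
  induction hx using Submodule.span_induction with
  | mem x hx =>
    obtain ⟨σ, rfl, rfl⟩ := hx
    rw [hv, map_sum, Finset.sum_mul]
    refine Submodule.sum_mem _ fun k _ => ?_
    rw [map_smul, smul_mul_assoc]
    refine Submodule.smul_mem _ _ ?_
    by_cases hk : k ∈ σ
    · rw [ι_single_mul_eMon_of_mem hk]
      exact Submodule.zero_mem _
    · obtain ⟨ε, hε, h⟩ := exists_smul_eMon_insert (K := K) hk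
      rw [← inv_smul_smul₀ hε (ι K _ * _), ← h]
      exact Submodule.smul_mem _ _ (Submodule.subset_span ⟨_, by simp [hk], rfl⟩)
  | zero => simp
  | add x y _ _ hx hy => rw [mul_add]; exact Submodule.add_mem _ hx hy
  | smul a x _ hx => rw [mul_smul_comm]; exact Submodule.smul_mem _ _ hx

theorem prod_ι_mem_monSpan (l : List (Fin n → K)) :
    (l.map (ι K)).prod ∈ monSpan K n l.length := by
  induction l with
  | nil => exact Submodule.subset_span ⟨∅, by simp, by simp [eMon]⟩
  | cons v l ih => simpa using ι_mul_mem_monSpan v ih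

theorem matAlgMap_mem_monSpan (g : Matrix (Fin n) (Fin n) K) {d : ℕ} {x : ExtAlg K n}
    (hx : x ∈ monSpan K n d) : matAlgMap K g x ∈ monSpan K n d := by
  suffices h : monSpan K n d ≤ (monSpan K n d).comap (matAlgMap K g).toLinearMap from h hx
  refine Submodule.span_le.2 ?_
  rintro _ ⟨σ, rfl, rfl⟩
  have h := prod_ι_mem_monSpan
    ((σ.sort (· ≤ ·)).map fun k => g.mulVec (Pi.single k (1 : K)))
  simpa [eMon, map_list_prod, List.map_map, Function.comp_def, matAlgMap_ι] using h

end Monomials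

section Coordinates

variable {K : Type} [Field K] {n : ℕ}

/-- The linear functional on `E` reading off the coefficient of the monomial `e_τ`. -/
noncomputable def coordE (K : Type) [Field K] {n : ℕ} (τ : Finset (Fin n)) :
    ExtAlg K n →ₗ[K] K :=
  liftAlternating fun m =>
    if h : τ.card = m then
      Matrix.detRowAlternating.compLinearMap (LinearMap.funLeft K K (τ.orderEmbOfFin h))
    else 0

theorem eMon_eq_ιMulti (σ : Finset (Fin n)) :
    eMon K n σ = ιMulti K σ.card fun a => Pi.single (σ.orderEmbOfFin rfl a) (1 : K) := by
  rw [ιMulti_apply, eMon, ← σ.listMap_orderEmbOfFin_finRange rfl, List.map_map, List.ofFn_eq_map]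
  rfl

/-- The coefficients of `g · e_σ` are minors of `g`. -/
theorem coordE_matAlgMap_eMon (g : Matrix (Fin n) (Fin n) K) {τ σ : Finset (Fin n)}
    (h : τ.card = σ.card) :
    coordE K τ (matAlgMap K g (eMon K n σ)) =
      (Matrix.of fun a b => g (τ.orderEmbOfFin h b) (σ.orderEmbOfFin rfl a)).det := by
  rw [eMon_eq_ιMulti, matAlgMap, map_apply_ιMulti, coordE, liftAlternating_apply_ιMulti, dif_pos h]
  rw [AlternatingMap.compLinearMap_apply]
  change Matrix.det _ = _
  congr 1
  ext a b
  simp [LinearMap.funLeft_apply]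

theorem coordE_matAlgMap_eMon_of_card_ne (g : Matrix (Fin n) (Fin n) K) {τ σ : Finset (Fin n)}
    (h : τ.card ≠ σ.card) : coordE K τ (matAlgMap K g (eMon K n σ)) = 0 := by
  rw [eMon_eq_ιMulti, matAlgMap, map_apply_ιMulti, coordE, liftAlternating_apply_ιMulti, dif_neg h]
  rfl

theorem coordE_eMon_self (σ : Finset (Fin n)) : coordE K σ (eMon K n σ) = 1 := by
  rw [← matAlgMap_one_apply (eMon K n σ), coordE_matAlgMap_eMon 1 rfl,
    ← Matrix.det_one (n := Fin σ.card)]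
  congr 1
  ext a b
  simp [Matrix.one_apply, eq_comm]

theorem coordE_eMon_of_ne {τ σ : Finset (Fin n)} (h : τ ≠ σ) : coordE K τ (eMon K n σ) = 0 := by
  rw [← matAlgMap_one_apply (eMon K n σ)]
  by_cases hc : τ.card = σ.card
  · rw [coordE_matAlgMap_eMon 1 hc]
    obtain ⟨k, hk, hkτ⟩ := Finset.not_subset.1
      fun hs : σ ⊆ τ => h (Finset.eq_of_subset_of_card_le hs hc.le).symm
    obtain ⟨a, rfl⟩ : k ∈ Set.range (σ.orderEmbOfFin rfl) := by simpa using hk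
    refine Matrix.det_eq_zero_of_row_eq_zero a fun b => ?_
    rw [Matrix.of_apply, Matrix.one_apply_ne]
    rintro hb
    exact hkτ (hb ▸ Finset.orderEmbOfFin_mem _ _ _)
  · exact coordE_matAlgMap_eMon_of_card_ne 1 hc

theorem eMon_ne_zero (σ : Finset (Fin n)) : eMon K n σ ≠ 0 := fun h => by
  simpa [h] using coordE_eMon_self (K := K) σ

/-- An element of degree `d` is the sum of its monomial components. -/
theorem eq_sum_coordE_of_mem_monSpan {d : ℕ} {x : ExtAlg K n} (hx : x ∈ monSpan K n d) :
    x = ∑ σ with σ.card = d, coordE K σ x • eMon K n σ := by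
  induction hx using Submodule.span_induction with
  | mem x hx =>
    obtain ⟨σ, rfl, rfl⟩ := hx
    rw [Finset.sum_eq_single_of_mem σ (by simp), coordE_eMon_self, one_smul]
    intro τ _ h
    rw [coordE_eMon_of_ne h, zero_smul]
  | zero => simp
  | add x y _ _ hx hy =>
    simp only [map_add, add_smul, Finset.sum_add_distrib]
    rw [← hx, ← hy]
  | smul a x _ hx =>
    simp only [map_smul, smul_assoc, ← Finset.smul_sum]
    rw [← hx]

/-- A face is never in the face ideal of a simplicial complex. -/
theorem eMon_notMem_faceIdealE {Δ : Set (Finset (Fin n))}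
    (hΔ : ∀ σ ∈ Δ, ∀ τ : Finset (Fin n), τ ⊆ σ → τ ∈ Δ) {σ : Finset (Fin n)} (hσ : σ ∈ Δ) :
    eMon K n σ ∉ faceIdealE K Δ := by
  intro hmem
  let g : Matrix (Fin n) (Fin n) K := Matrix.diagonal fun k => if k ∈ σ then 1 else 0
  have hle : faceIdealE K Δ ≤ LinearMap.ker (matAlgMap K g).toLinearMap := by
    refine Submodule.span_le.2 ?_
    rintro _ ⟨_, ⟨ρ, hρ, rfl⟩, u, v, rfl⟩
    obtain ⟨k, hk, hkσ⟩ := Finset.not_subset.1 fun h => hρ (hΔ σ hσ ρ h)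
    have := matAlgMap_eMon_of_killed (K := K) (g := g) hk (by ext l; simp [g, hkσ])
    simp [this]
  have h0 : matAlgMap K g (eMon K n σ) = 0 := hle hmem
  rw [matAlgMap_eMon_of_fixed fun k hk => by simp [g, hk]] at h0
  exact eMon_ne_zero σ h0

theorem eMon_mem_faceIdealE {Δ : Set (Finset (Fin n))} {σ : Finset (Fin n)} (hσ : σ ∉ Δ) :
    eMon K n σ ∈ faceIdealE K Δ :=
  Submodule.subset_span ⟨_, ⟨σ, hσ, rfl⟩, 1, 1, by simp⟩

end Coordinates

section Semicontinuity

variable {K : Type} [Field K] {κ : Type}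

/-- The algebra of polynomial functions on `K^κ`. -/
noncomputable def polyFun (K κ : Type) [Field K] : Subalgebra K ((κ → K) → K) :=
  (MvPolynomial.aeval fun (k : κ) (x : κ → K) => x k).range

theorem coordinate_mem_polyFun (k : κ) : (fun x : κ → K => x k) ∈ polyFun K κ :=
  ⟨MvPolynomial.X k, by simp⟩

theorem exists_eval_of_mem_polyFun {f : (κ → K) → K} (hf : f ∈ polyFun K κ) :
    ∃ q : MvPolynomial κ K, ∀ x, MvPolynomial.eval x q = f x := by
  obtain ⟨q, rfl⟩ := hf
  refine ⟨q, fun x => ?_⟩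
  have h : (MvPolynomial.aeval x : MvPolynomial κ K →ₐ[K] K) =
      (Pi.evalAlgHom K (fun _ : κ → K => K) x).comp
        (MvPolynomial.aeval fun (k : κ) (x : κ → K) => x k) := by
    ext k; simp
  have := congrArg (fun φ : MvPolynomial κ K →ₐ[K] K => φ q) h
  simpa [MvPolynomial.aeval_eq_eval] using this

theorem det_mem_polyFun {m : Type} [Fintype m] [DecidableEq m] {M : (κ → K) → Matrix m m K}
    (hM : ∀ a b, (fun x => M x a b) ∈ polyFun K κ) : (fun x => (M x).det) ∈ polyFun K κ := by
  have : (fun x => (M x).det) = ∑ π : Equiv.Perm m,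
      ((Equiv.Perm.sign π : ℤ) : K) • ∏ a, fun x => M x (π a) a := by
    ext x
    simp [Matrix.det_apply', Finset.sum_apply, Finset.prod_apply]
  rw [this]
  exact Subalgebra.sum_mem _ fun π _ =>
    Subalgebra.smul_mem _ (Subalgebra.prod_mem _ fun a _ => hM _ _) _

/-- The dimension of the span of a family of vectors in `K^T`. -/
noncomputable def spanRank {T ι : Type} (v : ι → T → K) : ℕ :=
  Module.finrank K (Submodule.span K (Set.range v))

/-- Lower semicontinuity of the rank of a polynomial family of vectors. -/
theorem exists_poly_spanRank_le {T ι : Type} [Fintype T] (v : (κ → K) → ι → T → K)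
    (hv : ∀ a t, (fun x => v x a t) ∈ polyFun K κ) (x₀ : κ → K) :
    ∃ q : MvPolynomial κ K, MvPolynomial.eval x₀ q ≠ 0 ∧ ∀ x, MvPolynomial.eval x q ≠ 0 →
      spanRank (v x₀) ≤ spanRank (v x) := by
  obtain ⟨f, hf, -, hli⟩ := Submodule.exists_fun_fin_finrank_span_eq K (Set.range (v x₀))
  choose a ha using hf
  obtain ⟨ℓ, hℓ⟩ := (Fintype.linearCombination K f).exists_leftInverse_of_injective
    (LinearMap.ker_eq_bot.2 (hli.fintypeLinearCombination_injective))
  have hℓf : ∀ b, ℓ (f b) = Pi.single b 1 := fun b => by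
    have := LinearMap.congr_fun hℓ (Pi.single b 1)
    simpa using this
  let M : (κ → K) → Matrix _ _ K := fun x => Matrix.of fun b c => ℓ (v x (a b)) c
  obtain ⟨q, hq⟩ := exists_eval_of_mem_polyFun (det_mem_polyFun (K := K) (κ := κ) (M := M) (by
    classical
    intro b c
    have : (fun x => M x b c) = ∑ t, ℓ (Pi.single t 1) c • fun x => v x (a b) t := by
      ext x
      simp only [M, Matrix.of_apply]
      conv_lhs => rw [LinearMap.pi_apply_eq_sum_univ ℓ (v x (a b))]
      simp only [Finset.sum_apply, Pi.smul_apply, smul_eq_mul, mul_comm]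
      refine Finset.sum_congr rfl fun t _ => ?_
      have : (fun s => if t = s then (1 : K) else 0) = Pi.single t 1 := by
        ext s
        simp [Pi.single_apply, eq_comm]
      rw [this]
    rw [this]
    exact Subalgebra.sum_mem _ fun t _ => Subalgebra.smul_mem _ (hv _ _) _))
  refine ⟨q, ?_, fun x hx => ?_⟩
  · have : M x₀ = 1 := by
      ext b c
      simp only [M, Matrix.of_apply, ha, hℓf, Matrix.one_apply, Pi.single_apply, eq_comm]
    simp [hq, this]
  · rw [hq] at hx
    have h1 : LinearIndependent K (M x).row :=
      Matrix.linearIndependent_rows_of_det_ne_zero hx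
    have h2 : LinearIndependent K fun b => v x (a b) :=
      LinearIndependent.of_comp ℓ h1
    rw [spanRank, ← finrank_span_eq_card h2 |>.trans (Fintype.card_fin _)]
    refine Submodule.finrank_mono (Submodule.span_mono ?_)
    rintro _ ⟨b, rfl⟩
    exact ⟨a b, rfl⟩

end Semicontinuity

section Shifting

variable {K : Type} [Field K] {n : ℕ}

theorem mem_shiftOp_iff {Δ : Set (Finset (Fin n))} {i j : Fin n} (hij : i ≠ j)
    {σ : Finset (Fin n)} :
    σ ∈ shiftOp Δ i j ↔
      if i ∈ σ then σ ∈ Δ ∧ (j ∉ σ → insert j (σ.erase i) ∈ Δ)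
      else σ ∈ Δ ∨ (j ∈ σ ∧ insert i (σ.erase j) ∈ Δ) := by
  constructor
  · rintro ⟨τ, hτ, rfl⟩
    unfold shiftFace
    split_ifs with h₁ h₂ h₂
    · simp [hij] at h₂
    · right
      refine ⟨by simp, ?_⟩
      rw [Finset.erase_insert (by simp [h₁.2.1]), Finset.insert_erase h₁.1]
      exact hτ
    · refine ⟨hτ, fun hj => ?_⟩
      by_contra hc
      exact h₁ ⟨h₂, hj, hc⟩
    · exact Or.inl hτ
  · split_ifs with hi
    · rintro ⟨hσ, h⟩
      exact ⟨σ, hσ, if_neg fun hc => hc.2.2 (h hc.2.1)⟩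
    · rintro h
      by_cases hσ : σ ∈ Δ
      · exact ⟨σ, hσ, if_neg fun hc => hi hc.1⟩
      · obtain ⟨hj, h⟩ := h.resolve_left hσ
        have he : insert j ((insert i (σ.erase j)).erase i) = σ := by
          rw [Finset.erase_insert (by simp [hi]), Finset.insert_erase hj]
        refine ⟨_, h, ?_⟩
        unfold shiftFace
        rw [he, if_pos ⟨by simp, by simp [hij.symm], hσ⟩]

/-- `Shift_{ij}` preserves closure under taking subsets. -/
theorem isLowerSet_shiftOp {Δ : Set (Finset (Fin n))}
    (hΔ : ∀ σ ∈ Δ, ∀ τ : Finset (Fin n), τ ⊆ σ → τ ∈ Δ) {i j : Fin n} (hij : i ≠ j) :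
    ∀ σ ∈ shiftOp Δ i j, ∀ τ : Finset (Fin n), τ ⊆ σ → τ ∈ shiftOp Δ i j := by
  intro σ hσ τ hτ
  rw [mem_shiftOp_iff hij] at hσ ⊢
  split_ifs with hi
  · rw [if_pos (hτ hi)] at hσ
    refine ⟨hΔ σ hσ.1 τ hτ, fun hj => ?_⟩
    by_cases hjσ : j ∈ σ
    · exact hΔ σ hσ.1 _
        (Finset.insert_subset hjσ ((Finset.erase_subset _ _).trans hτ))
    · exact hΔ _ (hσ.2 hjσ) _ (Finset.insert_subset_insert _ (Finset.erase_subset_erase _ hτ))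
  · split_ifs at hσ with hiσ
    · exact Or.inl (hΔ σ hσ.1 τ hτ)
    · rcases hσ with hσ | ⟨hj, hσ⟩
      · exact Or.inl (hΔ σ hσ τ hτ)
      · by_cases hjτ : j ∈ τ
        · exact Or.inr ⟨hjτ, hΔ _ hσ _
            (Finset.insert_subset_insert _ (Finset.erase_subset_erase _ hτ))⟩
        · refine Or.inl (hΔ _ hσ _ fun k hk => ?_)
          have : k ≠ j := fun h => hjτ (h ▸ hk)
          simp [this, hτ hk]

/-- The matrix sending `e_j` to `s e_j + e_i` and fixing the other basis vectors. -/
noncomputable def shearMat (i j : Fin n) (s : K) : Matrix (Fin n) (Fin n) K :=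
  (1 : Matrix (Fin n) (Fin n) K).updateCol j (s • Pi.single j 1 + Pi.single i 1)

theorem shearMat_mulVec_self (i j : Fin n) (s : K) :
    (shearMat i j s).mulVec (Pi.single j 1) = s • Pi.single j 1 + Pi.single i 1 := by
  ext a
  simp [shearMat]

theorem shearMat_mulVec_of_ne (i : Fin n) {j k : Fin n} (s : K) (h : k ≠ j) :
    (shearMat i j s).mulVec (Pi.single k 1) = Pi.single k 1 := by
  ext a
  simp [shearMat, h, Matrix.one_apply, Pi.single_apply]

theorem shearMat_eMon_of_notMem (i : Fin n) {j : Fin n} (s : K) {σ : Finset (Fin n)}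
    (hj : j ∉ σ) : matAlgMap K (shearMat i j s) (eMon K n σ) = eMon K n σ :=
  matAlgMap_eMon_of_fixed fun _ hk => shearMat_mulVec_of_ne i s fun h => hj (h ▸ hk)

theorem shearMat_eMon_of_mem_of_mem {i j : Fin n} (hij : i ≠ j) (s : K) {σ : Finset (Fin n)}
    (hi : i ∈ σ) (hj : j ∈ σ) :
    matAlgMap K (shearMat i j s) (eMon K n σ) = s • eMon K n σ := by
  obtain ⟨ε, -, h⟩ := exists_smul_eMon_insert (K := K) (Finset.notMem_erase j σ)
  rw [Finset.insert_erase hj] at h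
  rw [h, map_smul, map_mul, matAlgMap_ι, shearMat_mulVec_self,
    shearMat_eMon_of_notMem i s (Finset.notMem_erase j σ), map_add, add_mul,
    ι_single_mul_eMon_of_mem (Finset.mem_erase.2 ⟨hij, hi⟩), map_smul, smul_mul_assoc, add_zero,
    smul_comm]

theorem exists_shearMat_eMon {i j : Fin n} {σ : Finset (Fin n)} (hi : i ∉ σ) (hj : j ∈ σ) :
    ∃ ε : K, ε ≠ 0 ∧ ∀ s : K, matAlgMap K (shearMat i j s) (eMon K n σ) =
      s • eMon K n σ + ε • eMon K n (insert i (σ.erase j)) := by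
  obtain ⟨ε, hε, h⟩ := exists_smul_eMon_insert (K := K) (Finset.notMem_erase j σ)
  obtain ⟨δ, hδ, h'⟩ := exists_smul_eMon_insert (K := K)
    (fun hc => hi (Finset.mem_of_mem_erase hc) : i ∉ σ.erase j)
  rw [Finset.insert_erase hj] at h
  refine ⟨ε * δ⁻¹, mul_ne_zero hε (inv_ne_zero hδ), fun s => ?_⟩
  rw [h, map_smul, map_mul, matAlgMap_ι, shearMat_mulVec_self,
    shearMat_eMon_of_notMem i s (Finset.notMem_erase j σ), map_add, add_mul, h', map_smul,
    smul_mul_assoc, smul_add, smul_comm, smul_smul (ε * δ⁻¹), inv_mul_cancel_right₀ hδ]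

/-- The degree-`d` part of the face ideal, spanned by the nonfaces of size `d`. -/
noncomputable def nonfaceSpan (K : Type) [Field K] {n : ℕ} (Δ : Set (Finset (Fin n))) (d : ℕ) :
    Submodule K (ExtAlg K n) :=
  Submodule.span K (Set.range fun σ : {σ : Finset (Fin n) // σ ∉ Δ ∧ σ.card = d} => eMon K n σ)

theorem eMon_mem_nonfaceSpan {Δ : Set (Finset (Fin n))} {d : ℕ} {σ : Finset (Fin n)}
    (hσ : σ ∉ Δ) (hd : σ.card = d) : eMon K n σ ∈ nonfaceSpan K Δ d :=
  Submodule.subset_span ⟨⟨σ, hσ, hd⟩, rfl⟩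

/-- The nonfaces of `Shift_{ij}(Δ)` are limits, as `s → 0`, of elements of the transforms of the
nonface span of `Δ` by `shearMat i j s`. -/
theorem exists_deformation {Δ : Set (Finset (Fin n))} {i j : Fin n} (hij : i ≠ j)
    {σ : Finset (Fin n)} (hσ : σ ∉ shiftOp Δ i j) :
    ∃ y : ExtAlg K n, ∀ s : K, s ≠ 0 → eMon K n σ + s • y ∈
      (nonfaceSpan K Δ σ.card).map (matAlgMap K (shearMat i j s)).toLinearMap := by
  rw [mem_shiftOp_iff hij] at hσ
  have mem : ∀ {τ : Finset (Fin n)} (s : K), τ ∉ Δ → τ.card = σ.card →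
      matAlgMap K (shearMat i j s) (eMon K n τ) ∈
        (nonfaceSpan K Δ σ.card).map (matAlgMap K (shearMat i j s)).toLinearMap :=
    fun s h hc => Submodule.mem_map_of_mem (eMon_mem_nonfaceSpan h hc)
  by_cases hΔ : σ ∈ Δ
  · have hi : i ∈ σ := by
      by_contra hi
      rw [if_neg hi] at hσ
      exact hσ (Or.inl hΔ)
    rw [if_pos hi] at hσ
    obtain ⟨hj, hn⟩ : j ∉ σ ∧ insert j (σ.erase i) ∉ Δ := by
      by_contra hc
      exact hσ ⟨hΔ, fun hj => by_contra fun hn => hc ⟨hj, hn⟩⟩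
    have hj' : j ∉ σ.erase i := fun h => hj (Finset.mem_of_mem_erase h)
    obtain ⟨ε, hε, h⟩ := exists_shearMat_eMon (K := K) (i := i) (j := j)
      (σ := insert j (σ.erase i)) (by simp [hij]) (by simp)
    rw [Finset.erase_insert hj', Finset.insert_erase hi] at h
    refine ⟨ε⁻¹ • eMon K n (insert j (σ.erase i)), fun s _ => ?_⟩
    have hm := Submodule.smul_mem _ ε⁻¹ (mem s hn (by
      rw [Finset.card_insert_of_notMem hj', Finset.card_erase_add_one hi]))
    rwa [h, smul_add, inv_smul_smul₀ hε, smul_comm, add_comm] at hm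
  · refine ⟨0, fun s hs => ?_⟩
    rw [smul_zero, add_zero]
    have hm := mem s hΔ rfl
    by_cases hj : j ∈ σ
    · by_cases hi : i ∈ σ
      · rw [shearMat_eMon_of_mem_of_mem hij s hi hj] at hm
        simpa [smul_smul, hs] using Submodule.smul_mem _ s⁻¹ hm
      · rw [if_neg hi] at hσ
        have hi' : i ∉ σ.erase j := fun h => hi (Finset.mem_of_mem_erase h)
        have hm' := mem s (fun h => hσ (Or.inr ⟨hj, h⟩))
          (by rw [Finset.card_insert_of_notMem hi', Finset.card_erase_add_one hj])
        rw [shearMat_eMon_of_notMem i s (by simp [hij.symm])] at hm'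
        obtain ⟨ε, -, h⟩ := exists_shearMat_eMon (K := K) hi hj
        rw [h] at hm
        have := Submodule.smul_mem _ s⁻¹ (Submodule.sub_mem _ hm (Submodule.smul_mem _ ε hm'))
        rwa [add_sub_cancel_right, inv_smul_smul₀ hs] at this
    · rwa [shearMat_eMon_of_notMem i s hj] at hm

end Shifting

section Rank

variable {K : Type} [Field K] {n : ℕ}

/-- The sets of size `d` contained in the first `i` elements of `[n]`. -/
abbrev InitialSets (n i d : ℕ) :=
  {τ : Finset (Fin n) // τ.card = d ∧ ∀ k ∈ τ, (k : ℕ) < i}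

/-- The projection of `E` to the coordinates of degree `d` supported on the first `i` variables. -/
noncomputable def truncE (K : Type) [Field K] (n i d : ℕ) :
    ExtAlg K n →ₗ[K] (InitialSets n i d → K) :=
  LinearMap.pi fun τ => coordE K τ.1

/-- The rank of the truncation of `g · J_d`, where `J_d` is the degree-`d` part of the
face ideal of `Δ`. -/
noncomputable def truncRank (K : Type) [Field K] {n : ℕ} (i d : ℕ) (Δ : Set (Finset (Fin n)))
    (g : Matrix (Fin n) (Fin n) K) : ℕ :=
  Module.finrank K
    ((nonfaceSpan K Δ d).map (truncE K n i d ∘ₗ (matAlgMap K g).toLinearMap))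

theorem truncRank_eq_spanRank (i d : ℕ) (Δ : Set (Finset (Fin n)))
    (g : Matrix (Fin n) (Fin n) K) :
    truncRank K i d Δ g = spanRank fun σ : {σ : Finset (Fin n) // σ ∉ Δ ∧ σ.card = d} =>
      truncE K n i d (matAlgMap K g (eMon K n σ)) := by
  rw [truncRank, spanRank, nonfaceSpan, Submodule.map_span, ← Set.range_comp]
  rfl

/-- Undoing a shift does not decrease the maximal truncated rank. -/
theorem exists_truncRank_shiftOp_le [Infinite K] (i d : ℕ) (Δ : Set (Finset (Fin n)))
    {a b : Fin n} (hab : a ≠ b) (g : Matrix (Fin n) (Fin n) K) :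
    ∃ h : Matrix (Fin n) (Fin n) K,
      truncRank K i d (shiftOp Δ a b) g ≤ truncRank K i d Δ h := by
  choose y hy using fun σ : {σ : Finset (Fin n) // σ ∉ shiftOp Δ a b ∧ σ.card = d} =>
    exists_deformation (K := K) hab σ.2.1
  let L := truncE K n i d ∘ₗ (matAlgMap K g).toLinearMap
  obtain ⟨q, hq0, hq⟩ := exists_poly_spanRank_le (K := K) (κ := Unit)
    (fun x (σ : {σ : Finset (Fin n) // σ ∉ shiftOp Δ a b ∧ σ.card = d}) =>
      L (eMon K n σ) + x () • L (y σ)) (by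
      intro σ τ
      simp only [Pi.add_apply, Pi.smul_apply, smul_eq_mul]
      exact Subalgebra.add_mem _ (Subalgebra.algebraMap_mem _ (L (eMon K n σ) τ))
        (Subalgebra.mul_mem _ (coordinate_mem_polyFun ())
          (Subalgebra.algebraMap_mem _ (L (y σ) τ)))) 0
  obtain ⟨x, hx⟩ : ∃ x, MvPolynomial.eval x (q * MvPolynomial.X ()) ≠ 0 := by
    by_contra! hc
    have : q * MvPolynomial.X () = 0 := MvPolynomial.funext fun x => by simpa using hc x
    rcases mul_eq_zero.1 this with h | h
    · simp [h] at hq0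
    · exact MvPolynomial.X_ne_zero _ h
  rw [map_mul, MvPolynomial.eval_X] at hx
  refine ⟨g * shearMat a b (x ()), ?_⟩
  rw [truncRank_eq_spanRank]
  have hle := hq x (left_ne_zero_of_mul hx)
  simp only [Pi.zero_apply, zero_smul, add_zero] at hle
  refine hle.trans (Submodule.finrank_mono ?_)
  rw [Submodule.span_le]
  rintro _ ⟨σ, rfl⟩
  obtain ⟨z, hz, hzσ⟩ := hy σ (x ()) (right_ne_zero_of_mul hx)
  rw [σ.2.2] at hz
  refine ⟨z, hz, ?_⟩
  simp only [← map_smul L, ← map_add L, ← hzσ]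
  simp [L, matAlgMap_mul_apply]

theorem exists_truncRank_foldl_le [Infinite K] (i d : ℕ) (l : List (Fin n × Fin n))
    (hl : ∀ p ∈ l, p.1 < p.2) (Δ : Set (Finset (Fin n))) (g : Matrix (Fin n) (Fin n) K) :
    ∃ h : Matrix (Fin n) (Fin n) K,
      truncRank K i d (l.foldl (fun Γ p => shiftOp Γ p.1 p.2) Δ) g ≤ truncRank K i d Δ h := by
  induction l generalizing Δ with
  | nil => exact ⟨g, le_rfl⟩
  | cons p l ih =>
    obtain ⟨h, hh⟩ := ih (fun q hq => hl q (List.mem_cons_of_mem _ hq)) (shiftOp Δ p.1 p.2)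
    obtain ⟨h', hh'⟩ := exists_truncRank_shiftOp_le i d Δ (hl p List.mem_cons_self).ne h
    exact ⟨h', hh.trans hh'⟩

theorem isLowerSet_foldl_shiftOp (l : List (Fin n × Fin n)) (hl : ∀ p ∈ l, p.1 < p.2)
    (Δ : Set (Finset (Fin n))) (hΔ : ∀ σ ∈ Δ, ∀ τ : Finset (Fin n), τ ⊆ σ → τ ∈ Δ) :
    ∀ σ ∈ l.foldl (fun Γ p => shiftOp Γ p.1 p.2) Δ, ∀ τ : Finset (Fin n), τ ⊆ σ →
      τ ∈ l.foldl (fun Γ p => shiftOp Γ p.1 p.2) Δ := by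
  induction l generalizing Δ with
  | nil => exact hΔ
  | cons p l ih =>
    exact ih (fun q hq => hl q (List.mem_cons_of_mem _ hq)) _
      (isLowerSet_shiftOp hΔ (hl p List.mem_cons_self).ne)

/-- For a simplicial complex, the monomials counted by `m_{≤i}(J_Δ, d)` stay independent after
truncation. -/
theorem mLeE_faceIdealE_le_truncRank {Δ : Set (Finset (Fin n))}
    (hΔ : ∀ σ ∈ Δ, ∀ τ : Finset (Fin n), τ ⊆ σ → τ ∈ Δ) (i d : ℕ) :
    mLeE (faceIdealE K Δ) i d ≤ truncRank K i d Δ 1 := by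
  classical
  let S := {σ : Finset (Fin n) //
    σ.card = d ∧ (∀ k ∈ σ, (k : ℕ) < i) ∧ eMon K n σ ∈ faceIdealE K Δ}
  let f : S → InitialSets n i d := fun σ => ⟨σ.1, σ.2.1, σ.2.2.1⟩
  have hf : Function.Injective f := fun σ τ h =>
    Subtype.ext (congrArg (fun ρ : InitialSets n i d => ρ.1) h)
  have hli : LinearIndependent K fun σ : S => (Pi.single (f σ) (1 : K) : InitialSets n i d → K) :=
    (Pi.linearIndependent_single_one _ K).comp f hf
  have hval : ∀ σ : S, truncE K n i d (eMon K n σ.1) = Pi.single (f σ) 1 := fun σ => by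
    ext τ
    by_cases h : τ = f σ
    · subst h
      simp [truncE, f, coordE_eMon_self]
    · have : τ.1 ≠ σ.1 := fun hc => h (Subtype.ext hc)
      simp [truncE, h, coordE_eMon_of_ne this]
  change Nat.card S ≤ _
  rw [Nat.card_eq_fintype_card, ← finrank_span_eq_card hli]
  refine Submodule.finrank_mono (Submodule.span_le.2 ?_)
  rintro _ ⟨σ, rfl⟩
  refine ⟨eMon K n σ.1, eMon_mem_nonfaceSpan ?_ σ.2.1, ?_⟩
  · exact fun h => eMon_notMem_faceIdealE hΔ h σ.2.2.2
  · simp [matAlgMap_one_apply, hval]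

theorem truncE_matAlgMap_mem_polyFun {i d : ℕ} {σ : Finset (Fin n)} (hσ : σ.card = d)
    (τ : InitialSets n i d) :
    (fun x : Fin n × Fin n → K => truncE K n i d
      (matAlgMap K (Matrix.of fun k l => x (k, l)) (eMon K n σ)) τ) ∈
        polyFun K (Fin n × Fin n) := by
  have h : τ.1.card = σ.card := τ.2.1.trans hσ.symm
  have he : (fun x : Fin n × Fin n → K => truncE K n i d
      (matAlgMap K (Matrix.of fun k l => x (k, l)) (eMon K n σ)) τ) = fun x =>
        (Matrix.of fun a b => x (τ.1.orderEmbOfFin h b, σ.orderEmbOfFin rfl a)).det :=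
    funext fun x => coordE_matAlgMap_eMon _ h
  rw [he]
  exact det_mem_polyFun fun a b => coordinate_mem_polyFun _

/-- The truncated rank is lower semicontinuous in the matrix. -/
theorem exists_poly_truncRank_le (i d : ℕ) (Δ : Set (Finset (Fin n)))
    (g₀ : Matrix (Fin n) (Fin n) K) :
    ∃ q : MvPolynomial (Fin n × Fin n) K, q ≠ 0 ∧ ∀ g : Matrix (Fin n) (Fin n) K,
      MvPolynomial.eval (fun kl => g kl.1 kl.2) q ≠ 0 →
        truncRank K i d Δ g₀ ≤ truncRank K i d Δ g := by
  have key : ∀ x₀ : Fin n × Fin n → K, ∃ q : MvPolynomial (Fin n × Fin n) K,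
      MvPolynomial.eval x₀ q ≠ 0 ∧ ∀ x, MvPolynomial.eval x q ≠ 0 →
        truncRank K i d Δ (Matrix.of fun k l => x₀ (k, l)) ≤
          truncRank K i d Δ (Matrix.of fun k l => x (k, l)) := by
    intro x₀
    simp only [truncRank_eq_spanRank]
    exact exists_poly_spanRank_le (fun x (σ : {σ : Finset (Fin n) // σ ∉ Δ ∧ σ.card = d}) =>
      truncE K n i d (matAlgMap K (Matrix.of fun k l => x (k, l)) (eMon K n σ)))
      (fun σ τ => truncE_matAlgMap_mem_polyFun σ.2.2 τ) x₀
  obtain ⟨q, hq0, hq⟩ := key fun kl => g₀ kl.1 kl.2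
  exact ⟨q, fun h => hq0 (by rw [h, map_zero]), fun g hg => hq (fun kl => g kl.1 kl.2) hg⟩

/-- An element of degree `d` with nonzero truncation has its initial monomial supported on the
first `i` variables. -/
theorem exists_isInitialMonomial {I : Submodule K (ExtAlg K n)} {i d : ℕ} {x : ExtAlg K n}
    (hxI : x ∈ I) (hxd : x ∈ monSpan K n d) (hx : truncE K n i d x ≠ 0) :
    ∃ σ : InitialSets n i d, IsInitialMonomial I σ.1 ∧ coordE K σ.1 x ≠ 0 := by
  classical
  obtain ⟨τ, hτ⟩ := Function.ne_iff.1 hx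
  let S : Finset (Finset (Fin n)) := {σ | σ.card = d ∧ coordE K σ x ≠ 0}
  have hτS : τ.1 ∈ S := by simpa [S, τ.2.1, truncE] using hτ
  obtain ⟨σ, hσS, hmin⟩ := S.exists_min_image (fun σ => toColex σ) ⟨_, hτS⟩
  obtain ⟨hσd, hσx⟩ : σ.card = d ∧ coordE K σ x ≠ 0 := by simpa [S] using hσS
  refine ⟨⟨σ, hσd, fun k hk => ?_⟩, ⟨x, hxI, ?_, fun hlt => ?_, fun h => by simp [h] at hσx⟩, hσx⟩
  · by_cases hkτ : k ∈ τ.1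
    · exact τ.2.2 k hkτ
    · obtain ⟨l, hl, -, hkl⟩ := Finset.Colex.toColex_le_toColex.1 (hmin _ hτS) hk hkτ
      exact lt_of_le_of_lt hkl (τ.2.2 l hl)
  · rw [eq_sum_coordE_of_mem_monSpan hxd]
    refine Submodule.sum_mem _ fun ρ hρ => ?_
    have hρd : ρ.card = d := by simpa using hρ
    by_cases h0 : coordE K ρ x = 0
    · simp [h0]
    · refine Submodule.smul_mem _ _ (Submodule.subset_span ⟨ρ, hρd.trans hσd.symm, ?_, rfl⟩)
      by_cases he : ρ = σ
      · exact Or.inl he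
      · refine Or.inr (Finset.Colex.toColex_lt_toColex_iff_exists_forall_lt.1 ?_)
        exact lt_of_le_of_ne (hmin ρ (by simp [S, hρd, h0]))
          fun h => he (toColex.injective h).symm
  · have hle : monSpanLt K σ ≤ LinearMap.ker (coordE K σ) := by
      refine Submodule.span_le.2 ?_
      rintro _ ⟨ρ, -, -, hne, rfl⟩
      exact coordE_eMon_of_ne hne.symm
    exact hσx (hle hlt)

/-- The truncated rank is at most the number of initial monomials in the first `i` variables. -/
theorem truncRank_le_mLeE_initialIdealE (i d : ℕ) (Δ : Set (Finset (Fin n)))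
    (g : Matrix (Fin n) (Fin n) K) :
    truncRank K i d Δ g ≤ mLeE (initialIdealE K (applyMat K g (faceIdealE K Δ))) i d := by
  classical
  set I := applyMat K g (faceIdealE K Δ)
  let S := {σ : Finset (Fin n) //
    σ.card = d ∧ (∀ k ∈ σ, (k : ℕ) < i) ∧ eMon K n σ ∈ initialIdealE K I}
  let f : S → InitialSets n i d := fun σ => ⟨σ.1, σ.2.1, σ.2.2.1⟩
  let W := (nonfaceSpan K Δ d).map (truncE K n i d ∘ₗ (matAlgMap K g).toLinearMap)
  have hinj : Function.Injective (LinearMap.funLeft K K f ∘ₗ W.subtype) := by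
    rw [← LinearMap.ker_eq_bot, LinearMap.ker_eq_bot']
    rintro ⟨_, u, hu, rfl⟩ h0
    by_contra hne
    have hule : nonfaceSpan K Δ d ≤ faceIdealE K Δ ⊓ monSpan K n d := by
      refine Submodule.span_le.2 ?_
      rintro _ ⟨σ, rfl⟩
      exact ⟨eMon_mem_faceIdealE σ.2.1, Submodule.subset_span ⟨_, σ.2.2, rfl⟩⟩
    obtain ⟨σ, hσ, hσu⟩ := exists_isInitialMonomial (I := I) (i := i)
      (Submodule.mem_map_of_mem (f := (matAlgMap K g).toLinearMap) (hule hu).1)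
      (matAlgMap_mem_monSpan g (hule hu).2) fun h => hne (Subtype.ext h)
    exact hσu (congrFun h0 ⟨σ.1, σ.2.1, σ.2.2, Submodule.subset_span ⟨_, hσ, rfl⟩⟩)
  have := LinearMap.finrank_le_finrank_of_injective hinj
  rw [Module.finrank_fintype_fun_eq_card, ← Nat.card_eq_fintype_card] at this
  exact this

end Rank

/-- **Corollary 2.6.** Let `Δ` be a simplicial complex on `[n]` over an infinite
field `K`, `Δe` its exterior algebraic shifted complex (so `J_{Δe} = Gin^E(J_Δ)`)
and `Δc` any combinatorial shifted complex of `Δ`. Then for all `i` and `d` one has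
`m_{≤i}(J_{Δe}, d) ≥ m_{≤i}(J_{Δc}, d)`. -/
theorem mLe_exterior_shifted_ge_combinatorial (K : Type) [Field K] [Infinite K] (n : ℕ)
    (Δ Δe Δc : Set (Finset (Fin n))) (hΔ : IsSimplicialComplex Δ)
    (hΔe : IsSimplicialComplex Δe)
    (hgin : IsGinE (faceIdealE K Δ) (faceIdealE K Δe))
    (hΔc : IsCombinatorialShiftedComplex Δ Δc) (i d : ℕ) :
    mLeE (faceIdealE K Δc) i d ≤ mLeE (faceIdealE K Δe) i d := by
  obtain ⟨p, hp, hgin⟩ := hgin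
  obtain ⟨l, hl, rfl, -⟩ := hΔc
  obtain ⟨g₀, hg₀⟩ := exists_truncRank_foldl_le (K := K) i d l hl Δ 1
  obtain ⟨q, hq, hrank⟩ := exists_poly_truncRank_le i d Δ g₀
  obtain ⟨x, hx⟩ : ∃ x, MvPolynomial.eval x
      (p * q * (Matrix.mvPolynomialX (Fin n) (Fin n) K).det) ≠ 0 := by
    by_contra! hc
    exact mul_ne_zero (mul_ne_zero hp hq) (Matrix.det_mvPolynomialX_ne_zero (Fin n) K)
      (MvPolynomial.funext fun x => by simpa using hc x)
  let g : Matrix (Fin n) (Fin n) K := Matrix.of fun k l => x (k, l)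
  have hdet : MvPolynomial.eval x (Matrix.mvPolynomialX (Fin n) (Fin n) K).det = g.det := by
    rw [RingHom.map_det]
    congr 1
    ext k l
    simp [g]
  rw [map_mul, map_mul, hdet] at hx
  have hg := hgin g (right_ne_zero_of_mul hx).isUnit
    (left_ne_zero_of_mul (left_ne_zero_of_mul hx))
  rw [← hg]
  exact (mLeE_faceIdealE_le_truncRank (isLowerSet_foldl_shiftOp l hl Δ hΔ.2) i d).trans
    (hg₀.trans ((hrank g (right_ne_zero_of_mul (left_ne_zero_of_mul hx))).trans
      (truncRank_le_mLeE_initialIdealE i d Δ g)))
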